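/- Let X and Y be infinite-dimensional real Banach spaces, let S be a subset of X, and let T be a uniform quotient map from S onto Y which is Lipschitz for large distances. Then for every t ∈ (0,1], (2/3)·β̄_X(C^T t / (12 L₁^T)) ≤ ρ̄_Y(t). -/

import Mathlib

open Set Metric Filter Topology

noncomputable section

/-- `T` is a uniform quotient map on `S`: uniformly continuous and co-uniformly
continuous (with closed balls). -/
def UniformQuotientOn {X Y : Type*} [NormedAddCommGroup X] [NormedAddCommGroup Y]
    (T : X → Y) (S : Set X) : Prop :=
  (∀ ε > 0, ∃ δ > 0, ∀ x ∈ S, ∀ x' ∈ S, ‖x - x'‖ ≤ δ → ‖T x - T x'‖ ≤ ε) ∧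
  (∀ ε > 0, ∃ δ > 0, ∀ x ∈ S, closedBall (T x) δ ⊆ T '' (closedBall x ε ∩ S))

/-- The set of ratios `‖Tx - Tx'‖ / ‖x - x'‖` over pairs of points of `S` at distance `≥ d`. -/
def LargeDistRatioSet {X Y : Type*} [NormedAddCommGroup X] [NormedAddCommGroup Y]
    (T : X → Y) (S : Set X) (d : ℝ) : Set ℝ :=
  {r | ∃ x ∈ S, ∃ x' ∈ S, d ≤ ‖x - x'‖ ∧ r = ‖T x - T x'‖ / ‖x - x'‖}

/-- `L_d^T`, the Lipschitz constant of `T` for distances `≥ d`. -/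
noncomputable def Ld {X Y : Type*} [NormedAddCommGroup X] [NormedAddCommGroup Y]
    (T : X → Y) (S : Set X) (d : ℝ) : ℝ :=
  sSup (LargeDistRatioSet T S d)

/-- `T` is Lipschitz for large distances: `L_d^T < ∞` for every `d > 0`. -/
def LipschitzLargeDist {X Y : Type*} [NormedAddCommGroup X] [NormedAddCommGroup Y]
    (T : X → Y) (S : Set X) : Prop :=
  ∀ d > 0, BddAbove (LargeDistRatioSet T S d)

/-- The set of co-Lipschitz constants valid for all radii `r ≥ d`. -/
def CoLipSet {X Y : Type*} [NormedAddCommGroup X] [NormedAddCommGroup Y]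
    (T : X → Y) (S : Set X) (d : ℝ) : Set ℝ :=
  {c | 0 < c ∧ ∀ r, d ≤ r → ∀ x ∈ S, ∀ y : Y, ‖y - T x‖ < c * r →
      y ∈ T '' (closedBall x r ∩ S)}

/-- `c_d^T`. -/
noncomputable def cdT {X Y : Type*} [NormedAddCommGroup X] [NormedAddCommGroup Y]
    (T : X → Y) (S : Set X) (d : ℝ) : ℝ :=
  sSup (CoLipSet T S d)

/-- `C^T = lim_{d → ∞} c_d^T` (the limit of the nondecreasing family `c_d^T`,
i.e. its supremum). -/
noncomputable def CT {X Y : Type*} [NormedAddCommGroup X] [NormedAddCommGroup Y]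
    (T : X → Y) (S : Set X) : ℝ :=
  sSup {c | ∃ d, 0 < d ∧ c = cdT T S d}

/-- The set of admissible `δ`'s in the definition of the modulus `β̄_X(t)`. -/
def betaModSet (X : Type*) [NormedAddCommGroup X] (t : ℝ) : Set ℝ :=
  {δ | 0 ≤ δ ∧ ∀ x ∈ closedBall (0 : X) 1, ∀ xs : ℕ → X,
      (∀ n, xs n ∈ closedBall (0 : X) 1) →
      (∀ m n, m ≠ n → t ≤ ‖xs m - xs n‖) →
      ∃ n, ‖x - xs n‖ / 2 ≤ 1 - δ}

/-- The modulus `β̄_X(t)` of property (β) of Rolewicz. -/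
noncomputable def betaMod (X : Type*) [NormedAddCommGroup X] (t : ℝ) : ℝ :=
  sSup (betaModSet X t)

/-- Property (β) of Rolewicz. -/
def PropertyBeta (X : Type*) [NormedAddCommGroup X] : Prop :=
  ∃ a, 1 ≤ a ∧ a ≤ 2 ∧ ∀ t, 0 < t → t ≤ a → ∃ δ, 0 < δ ∧
    ∀ x ∈ closedBall (0 : X) 1, ∀ xs : ℕ → X,
      (∀ n, xs n ∈ closedBall (0 : X) 1) →
      (∀ m n, m ≠ n → t ≤ ‖xs m - xs n‖) →
      ∃ n, ‖x - xs n‖ / 2 ≤ 1 - δ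

/-- `Z` is a closed subspace of finite codimension. -/
def FinCodim {Y : Type*} [NormedAddCommGroup Y] [NormedSpace ℝ Y] (Z : Subspace ℝ Y) : Prop :=
  IsClosed (Z : Set Y) ∧ FiniteDimensional ℝ (Y ⧸ Z)

/-- `ρ̄_Y(t, y) = inf_Z sup_{z ∈ S_Z} (‖y + tz‖ - 1)`. -/
noncomputable def rhoAt {Y : Type*} [NormedAddCommGroup Y] [NormedSpace ℝ Y]
    (t : ℝ) (y : Y) : ℝ :=
  sInf {s | ∃ Z : Subspace ℝ Y, FinCodim Z ∧
    s = sSup {r | ∃ z ∈ Z, ‖z‖ = 1 ∧ r = ‖y + t • z‖ - 1}}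

/-- The modulus of asymptotic uniform smoothness `ρ̄_Y(t)`. -/
noncomputable def rhoMod (Y : Type*) [NormedAddCommGroup Y] [NormedSpace ℝ Y] (t : ℝ) : ℝ :=
  sSup {r | ∃ y : Y, ‖y‖ = 1 ∧ r = rhoAt t y}

/-- `δ̄_Y(t, y) = sup_Z inf_{z ∈ S_Z} (‖y + tz‖ - 1)`. -/
noncomputable def deltaAt {Y : Type*} [NormedAddCommGroup Y] [NormedSpace ℝ Y]
    (t : ℝ) (y : Y) : ℝ :=
  sSup {s | ∃ Z : Subspace ℝ Y, FinCodim Z ∧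
    s = sInf {r | ∃ z ∈ Z, ‖z‖ = 1 ∧ r = ‖y + t • z‖ - 1}}

/-- The modulus of asymptotic uniform convexity `δ̄_Y(t)`. -/
noncomputable def deltaMod (Y : Type*) [NormedAddCommGroup Y] [NormedSpace ℝ Y] (t : ℝ) : ℝ :=
  sInf {r | ∃ y : Y, ‖y‖ = 1 ∧ r = deltaAt t y}

/-- The norm of `Y` is asymptotically uniformly smooth. -/
def AUS (Y : Type*) [NormedAddCommGroup Y] [NormedSpace ℝ Y] : Prop :=
  Tendsto (fun t => rhoMod Y t / t) (𝓝[>] 0) (𝓝 0)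

/-- The norm of `Y` is asymptotically uniformly convex. -/
def AUC (Y : Type*) [NormedAddCommGroup Y] [NormedSpace ℝ Y] : Prop :=
  ∀ t > 0, 0 < deltaMod Y t

/-- A sequence is basic with basis constant at most `K`. -/
def IsBasicWithConst {Y : Type*} [NormedAddCommGroup Y] [NormedSpace ℝ Y]
    (K : ℝ) (e : ℕ → Y) : Prop :=
  ∀ (a : ℕ → ℝ) (m n : ℕ), m ≤ n →
    ‖∑ i ∈ Finset.range m, a i • e i‖ ≤ K * ‖∑ i ∈ Finset.range n, a i • e i‖

/-- A weakly null sequence. -/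
def WeaklyNull {Y : Type*} [NormedAddCommGroup Y] [NormedSpace ℝ Y] (xs : ℕ → Y) : Prop :=
  ∀ f : Y →L[ℝ] ℝ, Tendsto (fun n => f (xs n)) atTop (𝓝 0)

/-- Property (M) of Kalton. -/
def PropertyM (Y : Type*) [NormedAddCommGroup Y] [NormedSpace ℝ Y] : Prop :=
  ∀ u v : Y, ‖u‖ = 1 → ‖v‖ = 1 → ∀ xs : ℕ → Y, WeaklyNull xs →
    limsup (fun n => ‖u + xs n‖) atTop = limsup (fun n => ‖v + xs n‖) atTop

/-- `N` is a norm on `X` equivalent to the given one. -/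
def IsEquivNorm {X : Type*} [NormedAddCommGroup X] [NormedSpace ℝ X] (N : X → ℝ) : Prop :=
  (∀ x y, N (x + y) ≤ N x + N y) ∧
  (∀ (a : ℝ) (x : X), N (a • x) = |a| * N x) ∧
  (∃ c > 0, ∃ C > 0, ∀ x : X, c * ‖x‖ ≤ N x ∧ N x ≤ C * ‖x‖)

/-- The norm `N` has property (β) of Rolewicz. -/
def NormHasPropertyBeta {X : Type*} [NormedAddCommGroup X] (N : X → ℝ) : Prop :=
  ∃ a, 1 ≤ a ∧ a ≤ 2 ∧ ∀ t, 0 < t → t ≤ a → ∃ δ, 0 < δ ∧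
    ∀ x : X, N x ≤ 1 → ∀ xs : ℕ → X, (∀ n, N (xs n) ≤ 1) →
      (∀ m n, m ≠ n → t ≤ N (xs m - xs n)) →
      ∃ n, N (x - xs n) / 2 ≤ 1 - δ

theorem aux_bdd {X Y : Type*} [NormedAddCommGroup X] [NormedAddCommGroup Y]
    (S : Set X) (T : X → Y)
    (hT : UniformQuotientOn T S) (hLip : LipschitzLargeDist T S) (d : ℝ) (hd : 0 < d) :
    ∃ K, 0 ≤ K ∧ ∀ x ∈ S, ∀ x' ∈ S, ‖x - x'‖ ≤ d → ‖T x - T x'‖ ≤ K := by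
  obtain ⟨e, he, h1⟩ := hT.1 1 one_pos
  obtain ⟨M, hM⟩ := hLip e he
  refine ⟨1 + |M| * d, by positivity, fun x hx x' hx' h => ?_⟩
  by_cases hc : ‖x - x'‖ ≤ e
  · have := h1 x hx x' hx' hc
    have : 0 ≤ |M| * d := by positivity
    linarith
  · push Not at hc
    have h2 := hM ⟨x, hx, x', hx', hc.le, rfl⟩
    have h3 : 0 < ‖x - x'‖ := he.trans hc
    rw [div_le_iff₀ h3] at h2
    have h4 : M * ‖x - x'‖ ≤ |M| * d :=
      mul_le_mul (le_abs_self M) h h3.le (abs_nonneg M)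
    linarith

theorem aux_coBdd {X Y : Type*} [NormedAddCommGroup X]
    [NormedAddCommGroup Y] [NormedSpace ℝ Y] (u : Y) (hu : ‖u‖ = 1)
    (S : Set X) (T : X → Y) (hsurj : T '' S = Set.univ)
    (hT : UniformQuotientOn T S) (hLip : LipschitzLargeDist T S) (d : ℝ) (hd : 0 < d) :
    BddAbove (CoLipSet T S d) := by
  obtain ⟨K, hK, h⟩ := aux_bdd S T hT hLip d hd
  have : (0 : Y) ∈ T '' S := by rw [hsurj]; trivial
  obtain ⟨x, hx, -⟩ := this
  refine ⟨2 * K / d, fun c hc => ?_⟩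
  obtain ⟨hc0, hc⟩ := hc
  have hn : ‖(c * d / 2) • u‖ = c * d / 2 := by
    rw [norm_smul, hu, mul_one, Real.norm_of_nonneg (by positivity)]
  obtain ⟨x', ⟨hx'b, hx'⟩, hx'T⟩ := hc d le_rfl x hx (T x + (c * d / 2) • u) (by
    rw [add_sub_cancel_left, hn]
    have : 0 < c * d := by positivity
    linarith)
  have h2 := h x' hx' x hx (by simpa [dist_eq_norm] using hx'b)
  rw [hx'T, add_sub_cancel_left, hn] at h2
  rw [le_div_iff₀ hd]
  linarith

theorem aux_inner_bdd {Y : Type*} [NormedAddCommGroup Y] [NormedSpace ℝ Y]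
    (t : ℝ) (ht : 0 < t) (y : Y) (hy : ‖y‖ = 1) (Z : Subspace ℝ Y) :
    ∀ r ∈ {r | ∃ z ∈ Z, ‖z‖ = 1 ∧ r = ‖y + t • z‖ - 1}, r ≤ t := by
  rintro r ⟨z, hz, hz1, rfl⟩
  have := norm_add_le y (t • z)
  rw [norm_smul, hz1, hy, Real.norm_of_nonneg ht.le] at this
  linarith

theorem aux_inner_nonneg {Y : Type*} [NormedAddCommGroup Y] [NormedSpace ℝ Y]
    (t : ℝ) (ht : 0 < t) (y : Y) (hy : ‖y‖ = 1) (Z : Subspace ℝ Y) :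
    0 ≤ sSup {r | ∃ z ∈ Z, ‖z‖ = 1 ∧ r = ‖y + t • z‖ - 1} := by
  have hb : BddAbove {r | ∃ z ∈ Z, ‖z‖ = 1 ∧ r = ‖y + t • z‖ - 1} :=
    ⟨t, aux_inner_bdd t ht y hy Z⟩
  by_cases hz : ∃ z ∈ Z, ‖z‖ = 1
  · obtain ⟨z, hz, hz1⟩ := hz
    have h1 := le_csSup hb ⟨z, hz, hz1, rfl⟩
    have h2 := le_csSup hb ⟨-z, Z.neg_mem hz, by rwa [norm_neg], rfl⟩
    have h3 : ‖(2 : ℝ) • y‖ ≤ ‖y + t • z‖ + ‖y + t • (-z)‖ := by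
      refine le_trans (le_of_eq ?_) (norm_add_le _ _)
      congr 1
      module
    rw [norm_smul, hy] at h3
    norm_num at h3 h1 h2
    linarith
  · have : {r | ∃ z ∈ Z, ‖z‖ = 1 ∧ r = ‖y + t • z‖ - 1} = ∅ := by
      ext r
      simp only [mem_ofPred_eq, mem_empty_iff_false, iff_false]
      rintro ⟨z, h1, h2, -⟩
      exact hz ⟨z, h1, h2⟩
    rw [this, Real.sSup_empty]

theorem aux_top {Y : Type*} [NormedAddCommGroup Y] [NormedSpace ℝ Y] :
    FinCodim (⊤ : Subspace ℝ Y) := by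
  refine ⟨isClosed_univ, ?_⟩
  infer_instance

theorem aux_rhoAt {Y : Type*} [NormedAddCommGroup Y] [NormedSpace ℝ Y]
    (t : ℝ) (ht : 0 < t) (y : Y) (hy : ‖y‖ = 1) : 0 ≤ rhoAt t y ∧ rhoAt t y ≤ t := by
  have hb : ∀ s ∈ {s | ∃ Z : Subspace ℝ Y, FinCodim Z ∧
    s = sSup {r | ∃ z ∈ Z, ‖z‖ = 1 ∧ r = ‖y + t • z‖ - 1}}, 0 ≤ s := by
    rintro s ⟨Z, -, rfl⟩
    exact aux_inner_nonneg t ht y hy Z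
  refine ⟨Real.sInf_nonneg hb, ?_⟩
  refine (csInf_le ⟨0, hb⟩ ⟨⊤, aux_top, rfl⟩).trans ?_
  exact Real.sSup_le (aux_inner_bdd t ht y hy ⊤) ht.le

theorem aux_rhoMod {Y : Type*} [NormedAddCommGroup Y] [NormedSpace ℝ Y]
    (t : ℝ) (ht : 0 < t) : 0 ≤ rhoMod Y t ∧ rhoMod Y t ≤ t ∧
      ∀ y : Y, ‖y‖ = 1 → rhoAt t y ≤ rhoMod Y t := by
  have hb : ∀ r ∈ {r | ∃ y : Y, ‖y‖ = 1 ∧ r = rhoAt t y}, r ≤ t := by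
    rintro r ⟨y, hy, rfl⟩
    exact (aux_rhoAt t ht y hy).2
  refine ⟨Real.sSup_nonneg ?_, Real.sSup_le hb ht.le, fun y hy => le_csSup ⟨t, hb⟩ ⟨y, hy, rfl⟩⟩
  rintro r ⟨y, hy, rfl⟩
  exact (aux_rhoAt t ht y hy).1

/-- The separated sequence in `Y`. -/
theorem aux_seq {Y : Type*} [NormedAddCommGroup Y] [NormedSpace ℝ Y]
    (hY : ¬ FiniteDimensional ℝ Y) (t : ℝ) (ht : 0 < t) (u : Y) (hu : ‖u‖ = 1)
    (q : ℝ) (hq : rhoMod Y t < q) :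
    ∃ w : ℕ → Y, (∀ m n, m ≠ n → 1 / 2 ≤ ‖w m - w n‖) ∧
      ∀ n, ‖u + t • w n‖ ≤ 1 + q ∧ ‖u - t • w n‖ ≤ 1 + q := by
  obtain ⟨h0, -, h1⟩ := aux_rhoMod (Y := Y) t ht
  have h2 : rhoAt t u < q := (h1 u hu).trans_lt hq
  obtain ⟨s, ⟨Z, ⟨hZc, hZf⟩, rfl⟩, hs⟩ := exists_lt_of_csInf_lt
    (Set.nonempty_of_mem (show _ ∈ {s | ∃ Z : Subspace ℝ Y, FinCodim Z ∧
      s = sSup {r | ∃ z ∈ Z, ‖z‖ = 1 ∧ r = ‖u + t • z‖ - 1}} from ⟨⊤, aux_top, rfl⟩)) h2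
  have hq0 : 0 < q := h0.trans_lt hq
  have key : ∀ e ∈ Z, ‖e‖ ≤ 1 → ‖u + t • e‖ ≤ 1 + q := by
    intro e he he1
    by_cases hz : e = 0
    · subst hz
      rw [smul_zero, add_zero, hu]; linarith
    · have hn : 0 < ‖e‖ := norm_pos_iff.2 hz
      have h3 := le_csSup ⟨t, aux_inner_bdd t ht u hu Z⟩
        ⟨‖e‖⁻¹ • e, Z.smul_mem _ he, by rw [norm_smul, norm_inv, norm_norm, inv_mul_cancel₀ hn.ne'], rfl⟩
      have h4 : u + t • e = (1 - ‖e‖) • u + ‖e‖ • (u + t • (‖e‖⁻¹ • e)) := by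
        have : ‖e‖ • (t • (‖e‖⁻¹ • e)) = t • e := by
          rw [smul_comm, smul_smul ‖e‖, mul_inv_cancel₀ hn.ne', one_smul]
        rw [smul_add, this]
        module
      rw [h4]
      refine (norm_add_le _ _).trans ?_
      rw [norm_smul, norm_smul, hu, norm_norm, Real.norm_of_nonneg (by linarith)]
      have h5 : ‖u + t • (‖e‖⁻¹ • e)‖ ≤ 1 + q := by linarith
      nlinarith
  have hZi : ¬ FiniteDimensional ℝ Z := fun h => hY (Module.Finite.of_submodule_quotient Z)
  obtain ⟨f, hf1, hf2⟩ := exists_seq_norm_le_one_le_norm_sub' (𝕜 := ℝ) (c := 3 / 2)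
    (by norm_num) (R := 2) (by norm_num) hZi
  refine ⟨fun n => (1 / 2 : ℝ) • (f n : Y), fun m n hmn => ?_, fun n => ?_⟩
  · have := hf2 hmn
    rw [← smul_sub, norm_smul]
    have h6 : ‖(f m : Y) - f n‖ = ‖f m - f n‖ := rfl
    rw [h6]
    norm_num
    linarith
  · have hn : ‖(1 / 2 : ℝ) • (f n : Y)‖ ≤ 1 := by
      have := hf1 n
      have h6 : ‖(f n : Y)‖ = ‖f n‖ := rfl
      rw [norm_smul, h6]
      norm_num
      linarith
    have hm : (1 / 2 : ℝ) • (f n : Y) ∈ Z := Z.smul_mem _ (f n).2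
    refine ⟨key _ hm hn, ?_⟩
    have := key _ (Z.neg_mem hm) (by rwa [norm_neg])
    rwa [smul_neg, ← sub_eq_add_neg] at this

set_option maxHeartbeats 1000000 in
theorem aux_main {X Y : Type*} [NormedAddCommGroup X] [NormedSpace ℝ X]
    [NormedAddCommGroup Y] [NormedSpace ℝ Y]
    (hY : ¬ FiniteDimensional ℝ Y)
    (S : Set X) (T : X → Y) (hsurj : T '' S = Set.univ)
    (hT : UniformQuotientOn T S) (hLip : LipschitzLargeDist T S)
    (t : ℝ) (ht : 0 < t) (ht1 : t ≤ 1) (hC : 0 < CT T S) (hL : 0 < Ld T S 1)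
    (δ : ℝ) (hδ : δ ∈ betaModSet X (CT T S * t / (12 * Ld T S 1)))
    (hlt : rhoMod Y t < 2 / 3 * δ) : False := by
  obtain ⟨h0, hρt, -⟩ := aux_rhoMod (Y := Y) t ht
  obtain ⟨q, hq1, hq2⟩ := exists_between (show rhoMod Y t < min (2 / 3 * δ) (3 / 2) from
    lt_min hlt (by linarith))
  have hqδ := hq2.trans_le (min_le_left _ _)
  have hq3 := hq2.trans_le (min_le_right _ _)
  have hq0 : 0 < q := by linarith
  clear hq2
  have hA : (1 + q) * (1 - 2 / 3 * δ) < 1 := by nlinarith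
  set s := max ((1 + q) * (1 - 2 / 3 * δ)) (3 / 4) with hs
  have hs1 : s < 1 := max_lt hA (by norm_num)
  have hs2 : 3 / 4 ≤ s := le_max_right _ _
  have hs3 : (1 + q) * (1 - 2 / 3 * δ) ≤ s := le_max_left _ _
  clear_value s
  have hs0 : 0 < s := by linarith
  set C := CT T S with hCdef
  set L := Ld T S 1 with hLdef
  have hsC : s * C < C := by nlinarith
  have hsC0 : 0 < s * C := by positivity
  have hbd : BddAbove {c | ∃ d, 0 < d ∧ c = cdT T S d} := by
    by_contra h
    have : C = 0 := Real.sSup_of_not_bddAbove h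
    linarith
  obtain ⟨-, ⟨d0, hd0, rfl⟩, hcd⟩ := exists_lt_of_lt_csSup
    (Set.nonempty_of_mem (show _ ∈ {c | ∃ d, 0 < d ∧ c = cdT T S d} from ⟨1, one_pos, rfl⟩)) hsC
  have hne : (CoLipSet T S d0).Nonempty := by
    by_contra h
    rw [Set.not_nonempty_iff_eq_empty] at h
    rw [cdT, h, Real.sSup_empty] at hcd
    linarith
  obtain ⟨c0, ⟨hc0, hc0'⟩, hcs⟩ := exists_lt_of_lt_csSup hne hcd
  have hex : ∃ u : Y, ‖u‖ = 1 := by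
    have : Nontrivial Y := by
      by_contra h
      rw [not_nontrivial_iff_subsingleton] at h
      exact hY inferInstance
    exact exists_norm_eq Y zero_le_one
  obtain ⟨u0, hu0⟩ := hex
  obtain ⟨K, hK0, hK⟩ := aux_bdd S T hT hLip 1 one_pos
  set D := 3 * d0 + 6 * (K + 1) / (c0 * t) with hD
  have hDp : 0 < 6 * (K + 1) / (c0 * t) := by positivity
  have hD0 : 0 < D := by positivity
  have hnot : c0 / s ∉ CoLipSet T S D := by
    intro h
    have h1 : c0 / s ≤ cdT T S D := le_csSup (aux_coBdd u0 hu0 S T hsurj hT hLip D hD0) h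
    have h2 : cdT T S D ≤ C := le_csSup hbd ⟨D, hD0, rfl⟩
    have h3 := h1.trans h2
    rw [div_le_iff₀ hs0] at h3
    linarith
  have hnot2 : ¬ ∀ r, D ≤ r → ∀ x ∈ S, ∀ y : Y, ‖y - T x‖ < c0 / s * r →
      y ∈ T '' (closedBall x r ∩ S) := fun h => hnot ⟨by positivity, h⟩
  push Not at hnot2
  obtain ⟨R, hDR, z, hz, y, hy, hyn⟩ := hnot2
  have hR0 : 0 < R := hD0.trans_le hDR
  have hRd : 3 * d0 ≤ R := by linarith
  have hRK : K + 1 ≤ c0 * R * t / 6 := by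
    have h1 : 6 * (K + 1) / (c0 * t) ≤ R := by linarith
    rw [div_le_iff₀ (by positivity)] at h1
    linarith
  have ha1 : c0 * R ≤ ‖y - T z‖ := by
    by_contra h
    push Not at h
    exact hyn (hc0' R (by linarith) z hz y h)
  set a := ‖y - T z‖ with ha
  have ha0 : 0 < a := lt_of_lt_of_le (by positivity) ha1
  set u := a⁻¹ • (y - T z) with hu
  have hu1 : ‖u‖ = 1 := by
    rw [hu, norm_smul, norm_inv, Real.norm_of_nonneg ha0.le, ← ha, inv_mul_cancel₀ ha0.ne']
  have hau : y = T z + a • u := by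
    rw [hu, smul_smul, mul_inv_cancel₀ ha0.ne', one_smul]; abel
  clear_value u
  obtain ⟨w, hw1, hw2⟩ := aux_seq hY t ht u hu1 q hq1
  set r1 := R / (3 * s) with hr1
  have hr1' : r1 * (3 * s) = R := by rw [hr1]; field_simp
  have hr10 : 0 < r1 := by positivity
  have hr1d : d0 ≤ r1 := by rw [hr1, le_div_iff₀ (by positivity)]; nlinarith
  have har : a / 3 < c0 * r1 := by
    have : c0 * r1 = c0 / s * R / 3 := by rw [hr1]; field_simp
    rw [this]; linarith
  clear_value r1
  have ha3 : ‖a / 3‖ = a / 3 := Real.norm_of_nonneg (by positivity)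
  obtain ⟨x1, ⟨hx1b, hx1⟩, hx1T⟩ := hc0' r1 hr1d z hz (T z + (a / 3) • u) (by
    rw [add_sub_cancel_left, norm_smul, hu1, ha3]; linarith)
  set r2 := r1 * (1 + q) with hr2
  have hr12 : r1 ≤ r2 := by rw [hr2]; nlinarith
  have hr20 : 0 < r2 := by positivity
  have har2 : a / 3 * (1 + q) < c0 * r2 := by
    rw [hr2, ← mul_assoc]; exact mul_lt_mul_of_pos_right har (by linarith)
  have htip : ∀ n, ∃ x ∈ S, ‖x - x1‖ ≤ r2 ∧ T x = T x1 + (a / 3) • (u + t • w n) := by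
    intro n
    obtain ⟨x, ⟨hxb, hx⟩, hxT⟩ := hc0' r2 (hr1d.trans hr12) x1 hx1
      (T x1 + (a / 3) • (u + t • w n)) (by
        rw [add_sub_cancel_left, norm_smul, ha3]
        exact (mul_le_mul_of_nonneg_left (hw2 n).1 (by positivity)).trans_lt har2)
    exact ⟨x, hx, by simpa [dist_eq_norm] using hxb, hxT⟩
  choose x hxS hxb hxT using htip
  have hlast : ∀ n, ∃ x' ∈ S, ‖x' - x n‖ ≤ r2 ∧ T x' = y := by
    intro n
    have hdiff : y - T (x n) = (a / 3) • (u - t • w n) := by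
      rw [hxT, hx1T]
      nth_rewrite 1 [hau]
      module
    obtain ⟨x', ⟨hxb', hx'⟩, hxT'⟩ := hc0' r2 (hr1d.trans hr12) (x n) (hxS n) y (by
        rw [hdiff, norm_smul, ha3]
        exact (mul_le_mul_of_nonneg_left (hw2 n).2 (by positivity)).trans_lt har2)
    exact ⟨x', hx', by simpa [dist_eq_norm] using hxb', hxT'⟩
  have hsep : ∀ m n, m ≠ n → C * t / (12 * L) * r2 ≤ ‖x m - x n‖ := by
    intro m n hmn
    have e1 : T (x m) - T (x n) = (a / 3 * t) • (w m - w n) := by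
      rw [hxT, hxT]; module
    have e2 : c0 * R * t / 6 ≤ ‖T (x m) - T (x n)‖ := by
      rw [e1, norm_smul, Real.norm_of_nonneg (by positivity)]
      have e3 : a / 3 * t * (1 / 2) ≤ a / 3 * t * ‖w m - w n‖ :=
        mul_le_mul_of_nonneg_left (hw1 m n hmn) (by positivity)
      have e4 : c0 * R * t ≤ a * t := mul_le_mul_of_nonneg_right ha1 ht.le
      linarith
    have e5 : 1 < ‖x m - x n‖ := by
      by_contra h
      push Not at h
      have := hK _ (hxS m) _ (hxS n) h
      linarith
    have e6 : ‖T (x m) - T (x n)‖ / ‖x m - x n‖ ≤ L :=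
      le_csSup (hLip 1 one_pos) ⟨_, hxS m, _, hxS n, e5.le, rfl⟩
    rw [div_le_iff₀ (by linarith)] at e6
    have e7 : c0 * R * t / 6 ≤ L * ‖x m - x n‖ := e2.trans e6
    have e8 : C * t * r2 / 12 ≤ c0 * R * t / 6 := by
      have f1 : C * (1 + q) ≤ 6 * c0 * s := by
        have g1 : C * (1 + q) ≤ C * (5 / 2) := by
          apply mul_le_mul_of_nonneg_left _ hC.le; linarith
        have g2 : s * C * s ≤ c0 * s := mul_le_mul_of_nonneg_right hcs.le hs0.le
        have g3 : 3 / 4 * (3 / 4) ≤ s * s := mul_le_mul hs2 hs2 (by norm_num) hs0.le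
        have g4 : C * (3 / 4 * (3 / 4)) ≤ C * (s * s) := mul_le_mul_of_nonneg_left g3 hC.le
        linarith
      have f2 : C * (1 + q) * (t * r1) ≤ 6 * c0 * s * (t * r1) :=
        mul_le_mul_of_nonneg_right f1 (by positivity)
      rw [hr2, ← hr1']
      linarith
    have e9 : C * t / (12 * L) * r2 = C * t * r2 / 12 / L := by field_simp
    rw [e9, div_le_iff₀ hL]
    linarith
  have hinv : ∀ v : X, ‖r2⁻¹ • v‖ = ‖v‖ / r2 := fun v => by
    rw [norm_smul, norm_inv, Real.norm_of_nonneg hr20.le]; field_simp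
  obtain ⟨n, hn⟩ := hδ.2 (r2⁻¹ • (z - x1)) (by
      rw [mem_closedBall_zero_iff, hinv, div_le_one hr20]
      rw [mem_closedBall, dist_comm, dist_eq_norm] at hx1b
      linarith) (fun n => r2⁻¹ • (x n - x1)) (fun n => by
      rw [mem_closedBall_zero_iff, hinv, div_le_one hr20]
      exact hxb n) (fun m n hmn => by
      rw [← smul_sub, hinv, sub_sub_sub_cancel_right, le_div_iff₀ hr20]
      exact hsep m n hmn)
  rw [← smul_sub, hinv, sub_sub_sub_cancel_right, div_div, div_le_iff₀ (by positivity)] at hn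
  obtain ⟨x', hx'S, hx'b, hx'T⟩ := hlast n
  apply hyn
  refine ⟨x', ⟨?_, hx'S⟩, hx'T⟩
  rw [mem_closedBall, dist_eq_norm]
  have g1 : ‖x' - z‖ ≤ ‖x' - x n‖ + ‖x n - z‖ := norm_sub_le_norm_sub_add_norm_sub _ _ _
  rw [norm_sub_rev (x n)] at g1
  have g2 : ‖x' - z‖ ≤ 3 * r1 * ((1 + q) * (1 - 2 / 3 * δ)) := by
    rw [hr2] at hn hx'b
    linarith
  have g3 : 3 * r1 * ((1 + q) * (1 - 2 / 3 * δ)) ≤ 3 * r1 * s :=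
    mul_le_mul_of_nonneg_left hs3 (by positivity)
  linarith

/-- Corollary `betaAUS`. -/
theorem stmt1 {X Y : Type*} [NormedAddCommGroup X] [NormedSpace ℝ X] [CompleteSpace X]
    [NormedAddCommGroup Y] [NormedSpace ℝ Y] [CompleteSpace Y]
    (hX : ¬ FiniteDimensional ℝ X) (hY : ¬ FiniteDimensional ℝ Y)
    (S : Set X) (T : X → Y) (hsurj : T '' S = Set.univ)
    (hT : UniformQuotientOn T S) (hLip : LipschitzLargeDist T S) :
    ∀ t : ℝ, 0 < t → t ≤ 1 →
      (2 / 3) * betaMod X (CT T S * t / (12 * Ld T S 1)) ≤ rhoMod Y t := by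
  intro t ht ht1
  have h0 := (aux_rhoMod (Y := Y) t ht).1
  have hb : betaMod X (CT T S * t / (12 * Ld T S 1)) ≤ 3 / 2 * rhoMod Y t := by
    refine Real.sSup_le (fun δ hδ => ?_) (by positivity)
    by_cases ht0 : CT T S * t / (12 * Ld T S 1) ≤ 0
    · have : Nontrivial X := by
        by_contra h
        rw [not_nontrivial_iff_subsingleton] at h
        exact hX inferInstance
      obtain ⟨x, hx⟩ := exists_norm_eq X zero_le_one
      obtain ⟨n, hn⟩ := hδ.2 x (by simp [hx]) (fun _ => -x) (fun _ => by simp [hx])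
        (fun m n _ => by simpa using ht0)
      have : ‖x - -x‖ = 2 := by
        rw [sub_neg_eq_add, ← two_smul ℝ x, norm_smul, hx]; norm_num
      simp only [this] at hn
      linarith
    · push Not at ht0
      have hC0 : 0 ≤ CT T S := by
        refine Real.sSup_nonneg ?_
        rintro c ⟨d, -, rfl⟩
        exact Real.sSup_nonneg fun c hc => hc.1.le
      have hL0 : 0 ≤ Ld T S 1 := by
        refine Real.sSup_nonneg ?_
        rintro c ⟨x, -, x', -, -, rfl⟩
        positivity
      have hC : 0 < CT T S := by
        refine lt_of_le_of_ne hC0 fun h => ?_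
        rw [← h] at ht0; simp at ht0
      have hL : 0 < Ld T S 1 := by
        refine lt_of_le_of_ne hL0 fun h => ?_
        rw [← h] at ht0; simp at ht0
      by_contra hlt
      push Not at hlt
      exact aux_main hY S T hsurj hT hLip t ht ht1 hC hL δ hδ (by linarith)
  linarith

end
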